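/- arXiv:2311.14032 — 6 statements merged into one kernel-verified Lean document; each statement's English description precedes it below -/
import Mathlib

section
/- For every p in the density-ratio class R_c and every measurable set A ⊆ X, if the L-posterior probability of A equals α ∈ [0,1], then the p-posterior probability of A is at most α·c² / (1 − α + α·c²). -/
open MeasureTheory

/-- Density-ratio class upper bound on posterior probabilities:
if the `L`-posterior probability of `A` is `α ∈ [0,1]`, then for any `p` in the
density-ratio class `R_c` the `p`-posterior probability of `A` is at most
`α c² / (1 - α + α c²)`. -/
theorem densityRatio_posterior_upper_bound
    {X : Type*} [MeasurableSpace X] (π : Measure X) [SigmaFinite π]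
    (L : X → ℝ) (hLmeas : Measurable L) (hLnonneg : ∀ x, 0 ≤ L x)
    (hLint : Integrable L π) (hLpos : 0 < ∫ x, L x ∂π)
    (c : ℝ) (hc : 1 ≤ c)
    (p : X → ℝ) (hpmeas : Measurable p)
    (hp : ∀ x, L x / c ≤ p x ∧ p x ≤ c * L x)
    (A : Set X) (hA : MeasurableSet A)
    (α : ℝ) (hα0 : 0 ≤ α) (hα1 : α ≤ 1)
    (hpost : (∫ x in A, L x ∂π) / (∫ x, L x ∂π) = α) :
    (∫ x in A, p x ∂π) / (∫ x, p x ∂π) ≤ α * c ^ 2 / (1 - α + α * c ^ 2) := by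
  have hc0 : 0 < c := by linarith
  have hpnonneg : ∀ x, 0 ≤ p x := fun x => (div_nonneg (hLnonneg x) hc0.le).trans (hp x).1
  have hpint : Integrable p π := by
    refine (hLint.const_mul c).mono' hpmeas.aestronglyMeasurable (ae_of_all _ fun x => ?_)
    rw [Real.norm_of_nonneg (hpnonneg x)]
    exact (hp x).2
  have hupper : ∫ x in A, p x ∂π ≤ c * ∫ x in A, L x ∂π := by
    rw [← integral_const_mul]
    exact integral_mono hpint.integrableOn (hLint.const_mul c).integrableOn fun x => (hp x).2
  have hlower : ∫ x in Aᶜ, L x ∂π ≤ c * ∫ x in Aᶜ, p x ∂π := by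
    rw [← integral_const_mul]
    exact integral_mono hLint.integrableOn (hpint.const_mul c).integrableOn
      fun x => (div_le_iff₀' hc0).1 (hp x).1
  have htotal : ∫ x, L x ∂π ≤ c * ∫ x, p x ∂π := by
    rw [← integral_const_mul]
    exact integral_mono hLint (hpint.const_mul c) fun x => (div_le_iff₀' hc0).1 (hp x).1
  have hppos : 0 < ∫ x, p x ∂π := pos_of_mul_pos_right (hLpos.trans_le htotal) hc0.le
  have hLA : 0 ≤ ∫ x in A, L x ∂π := integral_nonneg hLnonneg
  have hLAc : 0 ≤ ∫ x in Aᶜ, L x ∂π := integral_nonneg hLnonneg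
  have hLsum := integral_add_compl hA hLint
  have hpsum := integral_add_compl hA hpint
  have hden : 0 < 1 - α + α * c ^ 2 := by nlinarith [mul_nonneg hα0 (sub_nonneg.2 hc)]
  have hαeq : ∫ x in A, L x ∂π = α * ∫ x, L x ∂π := (div_eq_iff hLpos.ne').1 hpost
  have hcross : (∫ x in A, p x ∂π) * ∫ x in Aᶜ, L x ∂π ≤
      (c * ∫ x in A, L x ∂π) * (c * ∫ x in Aᶜ, p x ∂π) :=
    mul_le_mul hupper hlower hLAc (mul_nonneg hc0.le hLA)
  have hcompl : ∫ x in Aᶜ, L x ∂π = (1 - α) * ∫ x, L x ∂π := by linarith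
  rw [div_le_div_iff₀ hppos hden, ← hpsum]
  rw [hcompl, hαeq] at hcross
  refine le_of_mul_le_mul_right ?_ hLpos
  linarith
end

section
/- For every measurable set A ⊆ X whose L-posterior probability equals α ∈ [0,1], the function p* defined by p*(x) = c·L(x) for x ∈ A and p*(x) = L(x)/c for x ∉ A belongs to the density-ratio class R_c, and its p*-posterior probability of A equals α·c² / (1 − α + α·c²); consequently sup_{p ∈ R_c} Post_p(A) = α·c² / (1 − α + α·c²). -/
open MeasureTheory
open scoped Classical

/-- A measurable function squeezed between `L / c` and `c * L`, with `L` nonnegative and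
integrable, is integrable. -/
lemma integrable_of_div_le_of_le_mul {X : Type*} [MeasurableSpace X] {π : Measure X}
    {L p : X → ℝ} (hLnonneg : ∀ x, 0 ≤ L x) (hLint : Integrable L π) {c : ℝ} (hc : 0 ≤ c)
    (hp : Measurable p) (hpL : ∀ x, L x / c ≤ p x ∧ p x ≤ c * L x) : Integrable p π := by
  refine (hLint.const_mul c).mono' hp.aestronglyMeasurable (ae_of_all _ fun x => ?_)
  rw [Real.norm_of_nonneg ((div_nonneg (hLnonneg x) hc).trans (hpL x).1)]
  exact (hpL x).2

/-- Increasing `P` and decreasing `Q` increases the odds ratio `P / (P + Q)`. -/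
lemma div_add_le_div_add {P P' Q Q' : ℝ} (hP' : 0 ≤ P') (hQ' : 0 ≤ Q') (hP : P ≤ P')
    (hQ : Q' ≤ Q) (h : 0 < P + Q) (h' : 0 < P' + Q') : P / (P + Q) ≤ P' / (P' + Q') := by
  rw [div_le_div_iff₀ h h']
  nlinarith [mul_le_mul hP hQ hQ' hP']

/-- The extremal density `p*` (equal to `c·L` on `A` and `L/c` off `A`) lies in the
density-ratio class `R_c`, attains posterior probability `α c² / (1 - α + α c²)` on `A`,
and consequently the supremum of posterior probabilities of `A` over `R_c` equals
`α c² / (1 - α + α c²)`. -/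
theorem densityRatio_posterior_sup
    {X : Type*} [MeasurableSpace X] (π : Measure X) [SigmaFinite π]
    (L : X → ℝ) (hLmeas : Measurable L) (hLnonneg : ∀ x, 0 ≤ L x)
    (hLint : Integrable L π) (hLpos : 0 < ∫ x, L x ∂π)
    (c : ℝ) (hc : 1 ≤ c)
    (A : Set X) (hA : MeasurableSet A)
    (α : ℝ) (hα0 : 0 ≤ α) (hα1 : α ≤ 1)
    (hpost : (∫ x in A, L x ∂π) / (∫ x, L x ∂π) = α)
    (pstar : X → ℝ) (hpstar : ∀ x, pstar x = if x ∈ A then c * L x else L x / c) :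
    (Measurable pstar ∧ ∀ x, L x / c ≤ pstar x ∧ pstar x ≤ c * L x) ∧
    (∫ x in A, pstar x ∂π) / (∫ x, pstar x ∂π) = α * c ^ 2 / (1 - α + α * c ^ 2) ∧
    sSup {r : ℝ | ∃ p : X → ℝ, Measurable p ∧ (∀ x, L x / c ≤ p x ∧ p x ≤ c * L x) ∧
        r = (∫ x in A, p x ∂π) / (∫ x, p x ∂π)} = α * c ^ 2 / (1 - α + α * c ^ 2) := by
  have hc0 : 0 < c := by linarith
  have hmem : Measurable pstar ∧ ∀ x, L x / c ≤ pstar x ∧ pstar x ≤ c * L x := by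
    refine ⟨?_, fun x => ?_⟩
    · rw [funext hpstar]
      exact Measurable.ite hA (hLmeas.const_mul c) (hLmeas.div_const c)
    · have h : L x / c ≤ c * L x :=
        (div_le_self (hLnonneg x) hc).trans (le_mul_of_one_le_left (hLnonneg x) hc)
      rw [hpstar]
      split_ifs
      · exact ⟨h, le_rfl⟩
      · exact ⟨le_rfl, h⟩
  have hsplit := integral_add_compl hA hLint
  have ha : ∫ x in A, L x ∂π = α * ∫ x, L x ∂π := (div_eq_iff hLpos.ne').1 hpost
  have hb : ∫ x in Aᶜ, L x ∂π = (1 - α) * ∫ x, L x ∂π := by linarith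
  have hstarA : ∫ x in A, pstar x ∂π = c * ∫ x in A, L x ∂π := by
    rw [← integral_const_mul]
    exact setIntegral_congr_fun hA fun x hx => by simp only [hpstar, if_pos hx]
  have hstarAc : ∫ x in Aᶜ, pstar x ∂π = (∫ x in Aᶜ, L x ∂π) / c := by
    rw [← integral_div]
    exact setIntegral_congr_fun hA.compl fun x hx => by simp only [hpstar, if_neg hx]
  have hintegrable {p : X → ℝ} (hp : Measurable p)
      (hpL : ∀ x, L x / c ≤ p x ∧ p x ≤ c * L x) : Integrable p π :=
    integrable_of_div_le_of_le_mul hLnonneg hLint hc0.le hp hpL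
  have hpos {p : X → ℝ} (hp : Measurable p)
      (hpL : ∀ x, L x / c ≤ p x ∧ p x ≤ c * L x) : 0 < ∫ x, p x ∂π := by
    refine (div_pos hLpos hc0).trans_le ?_
    rw [← integral_div]
    exact integral_mono (hLint.div_const c) (hintegrable hp hpL) fun x => (hpL x).1
  have hstar : (∫ x in A, pstar x ∂π) / (∫ x, pstar x ∂π)
      = α * c ^ 2 / (1 - α + α * c ^ 2) := by
    have hden : 0 < 1 - α + α * c ^ 2 := by nlinarith [mul_nonneg hα0 (sub_nonneg.2 hc)]
    rw [div_eq_div_iff (hpos hmem.1 hmem.2).ne' hden.ne',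
      ← integral_add_compl hA (hintegrable hmem.1 hmem.2), hstarA, hstarAc, ha, hb]
    field_simp
    ring
  refine ⟨hmem, hstar, IsGreatest.csSup_eq ⟨⟨pstar, hmem.1, hmem.2, hstar.symm⟩, ?_⟩⟩
  rintro r ⟨p, hp, hpL, rfl⟩
  have hp_pos := hpos hp hpL
  have hstar_pos := hpos hmem.1 hmem.2
  have hpint := hintegrable hp hpL
  have hstar_int := hintegrable hmem.1 hmem.2
  have hstar_nonneg (x : X) : 0 ≤ pstar x :=
    (div_nonneg (hLnonneg x) hc0.le).trans (hmem.2 x).1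
  rw [← hstar]
  rw [← integral_add_compl hA hpint] at hp_pos ⊢
  rw [← integral_add_compl hA hstar_int] at hstar_pos ⊢
  refine div_add_le_div_add (setIntegral_nonneg hA fun x _ => hstar_nonneg x)
    (setIntegral_nonneg hA.compl fun x _ => hstar_nonneg x) ?_ ?_ hp_pos hstar_pos
  · refine setIntegral_mono_on hpint.integrableOn hstar_int.integrableOn hA fun x hx => ?_
    rw [hpstar, if_pos hx]
    exact (hpL x).2
  · refine setIntegral_mono_on hstar_int.integrableOn hpint.integrableOn hA.compl fun x hx => ?_
    rw [hpstar, if_neg hx]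
    exact (hpL x).1
end

section
/- For every p in the density-ratio class R_c and every measurable set A ⊆ X, if the L-posterior probability of A equals α ∈ [0,1], then the p-posterior probability of A is at least α / (α + (1 − α)·c²). -/
open MeasureTheory

/-- Density-ratio class lower bound on posterior probabilities:
if the `L`-posterior probability of `A` is `α ∈ [0,1]`, then for any `p` in the
density-ratio class `R_c` the `p`-posterior probability of `A` is at least
`α / (α + (1 - α) c²)`. -/
theorem densityRatio_posterior_lower_bound
    {X : Type*} [MeasurableSpace X] (π : Measure X) [SigmaFinite π]
    (L : X → ℝ) (hLmeas : Measurable L) (hLnonneg : ∀ x, 0 ≤ L x)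
    (hLint : Integrable L π) (hLpos : 0 < ∫ x, L x ∂π)
    (c : ℝ) (hc : 1 ≤ c)
    (p : X → ℝ) (hpmeas : Measurable p)
    (hp : ∀ x, L x / c ≤ p x ∧ p x ≤ c * L x)
    (A : Set X) (hA : MeasurableSet A)
    (α : ℝ) (hα0 : 0 ≤ α) (hα1 : α ≤ 1)
    (hpost : (∫ x in A, L x ∂π) / (∫ x, L x ∂π) = α) :
    α / (α + (1 - α) * c ^ 2) ≤ (∫ x in A, p x ∂π) / (∫ x, p x ∂π) := by
  have hc0 : 0 < c := one_pos.trans_le hc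
  have hpnonneg : ∀ x, 0 ≤ p x := fun x => (div_nonneg (hLnonneg x) hc0.le).trans (hp x).1
  have hpint : Integrable p π := (hLint.const_mul c).mono' hpmeas.aestronglyMeasurable <|
    ae_of_all _ fun x => by
      rw [Real.norm_of_nonneg (hpnonneg x)]
      exact (hp x).2
  have hlower (B : Set X) : (∫ x in B, L x ∂π) / c ≤ ∫ x in B, p x ∂π := by
    rw [← integral_div]
    exact integral_mono (hLint.integrableOn.div_const c) hpint.integrableOn fun x => (hp x).1
  have hupper (B : Set X) : ∫ x in B, p x ∂π ≤ c * ∫ x in B, L x ∂π := by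
    rw [← integral_const_mul]
    exact integral_mono hpint.integrableOn (hLint.integrableOn.const_mul c) fun x => (hp x).2
  have hLsplit := integral_add_compl hA hLint
  have hpsplit := integral_add_compl hA hpint
  have hppos : 0 < ∫ x, p x ∂π := by
    have h := hlower Set.univ
    simp only [Measure.restrict_univ] at h
    exact (div_pos hLpos hc0).trans_le h
  have hLA : ∫ x in A, L x ∂π = α * ∫ x, L x ∂π := (div_eq_iff hLpos.ne').mp hpost
  have hLAc : ∫ x in Aᶜ, L x ∂π = (1 - α) * ∫ x, L x ∂π := by linarith
  have hA_le := hlower A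
  have hAc_le := hupper Aᶜ
  rw [hLA, div_le_iff₀ hc0] at hA_le
  rw [hLAc] at hAc_le
  have hβ : 0 ≤ 1 - α := sub_nonneg.mpr hα1
  have hden : 0 < α + (1 - α) * c ^ 2 := by
    linarith [le_mul_of_one_le_right hβ (one_le_pow₀ hc : 1 ≤ c ^ 2)]
  rw [div_le_div_iff₀ hden hppos, ← hpsplit]
  have h₁ := mul_le_mul_of_nonneg_left hAc_le hα0
  have h₂ := mul_le_mul_of_nonneg_left hA_le (mul_nonneg hβ hc0.le)
  linarith
end

section
/- For every measurable set A ⊆ X whose L-posterior probability equals α ∈ [0,1], the function p_* defined by p_*(x) = L(x)/c for x ∈ A and p_*(x) = c·L(x) for x ∉ A belongs to the density-ratio class R_c, and its p_*-posterior probability of A equals α / (α + (1 − α)·c²); consequently inf_{p ∈ R_c} Post_p(A) = α / (α + (1 − α)·c²). -/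
open MeasureTheory
open scoped Classical

/-- A measurable function squeezed between `L / c` and `c * L` is integrable when `L` is. -/
lemma integrable_of_densityRatio {X : Type*} [MeasurableSpace X] {π : Measure X} {L p : X → ℝ}
    {c : ℝ} (hc : 0 ≤ c) (hLnonneg : ∀ x, 0 ≤ L x) (hLint : Integrable L π) (hp : Measurable p)
    (hb : ∀ x, L x / c ≤ p x ∧ p x ≤ c * L x) : Integrable p π := by
  refine (hLint.const_mul c).mono' hp.aestronglyMeasurable (.of_forall fun x => ?_)
  rw [Real.norm_of_nonneg ((div_nonneg (hLnonneg x) hc).trans (hb x).1)]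
  exact (hb x).2

/-- Scaling the odds `a : b` to `a / c : c * b` sends the probability `α` to
`α / (α + (1 - α) * c ^ 2)`, where `α = a / (a + b)`. -/
lemma div_add_odds_scaling {a b c : ℝ} (ha : 0 ≤ a) (hb : 0 ≤ b) (hab : 0 < a + b) (hc : 0 < c) :
    a / c / (a / c + c * b) = a / (a + b) / (a / (a + b) + (1 - a / (a + b)) * c ^ 2) := by
  have hD : 0 < a + c ^ 2 * b := by
    rcases ha.eq_or_lt with rfl | ha'
    · have : 0 < b := by linarith
      positivity
    · positivity
  have h₁ : a / c + c * b = (a + c ^ 2 * b) / c := by field_simp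
  have h₂ : a / (a + b) + (1 - a / (a + b)) * c ^ 2 = (a + c ^ 2 * b) / (a + b) := by
    field_simp
    ring
  rw [h₁, h₂, div_div_div_cancel_right₀ hc.ne', div_div_div_cancel_right₀ hab.ne']

/-- The map `(P, Q) ↦ P / (P + Q)` is increasing in `P` and decreasing in `Q`. -/
lemma div_add_le_div_add_of_le {P Q P' Q' : ℝ} (hP : 0 ≤ P) (hQ' : 0 ≤ Q') (hPP' : P ≤ P')
    (hQQ' : Q' ≤ Q) (h : 0 < P + Q) (h' : 0 < P' + Q') : P / (P + Q) ≤ P' / (P' + Q') := by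
  rw [div_le_div_iff₀ h h']
  nlinarith [mul_le_mul hPP' hQQ' hQ' (hP.trans hPP')]

/-- The extremal density `p_*` (equal to `L/c` on `A` and `c·L` off `A`) lies in the
density-ratio class `R_c`, attains posterior probability `α / (α + (1 - α) c²)` on `A`,
and consequently the infimum of posterior probabilities of `A` over `R_c` equals
`α / (α + (1 - α) c²)`. -/
theorem densityRatio_posterior_inf
    {X : Type*} [MeasurableSpace X] (π : Measure X) [SigmaFinite π]
    (L : X → ℝ) (hLmeas : Measurable L) (hLnonneg : ∀ x, 0 ≤ L x)
    (hLint : Integrable L π) (hLpos : 0 < ∫ x, L x ∂π)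
    (c : ℝ) (hc : 1 ≤ c)
    (A : Set X) (hA : MeasurableSet A)
    (α : ℝ) (hα0 : 0 ≤ α) (hα1 : α ≤ 1)
    (hpost : (∫ x in A, L x ∂π) / (∫ x, L x ∂π) = α)
    (pstar : X → ℝ) (hpstar : ∀ x, pstar x = if x ∈ A then L x / c else c * L x) :
    (Measurable pstar ∧ ∀ x, L x / c ≤ pstar x ∧ pstar x ≤ c * L x) ∧
    (∫ x in A, pstar x ∂π) / (∫ x, pstar x ∂π) = α / (α + (1 - α) * c ^ 2) ∧
    sInf {r : ℝ | ∃ p : X → ℝ, Measurable p ∧ (∀ x, L x / c ≤ p x ∧ p x ≤ c * L x) ∧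
        r = (∫ x in A, p x ∂π) / (∫ x, p x ∂π)} = α / (α + (1 - α) * c ^ 2) := by
  have hc0 : 0 < c := zero_lt_one.trans_le hc
  set a := ∫ x in A, L x ∂π with ha_def
  set b := ∫ x in Aᶜ, L x ∂π with hb_def
  have ha : 0 ≤ a := integral_nonneg hLnonneg
  have hb : 0 ≤ b := integral_nonneg hLnonneg
  have hsum : ∫ x, L x ∂π = a + b := (integral_add_compl hA hLint).symm
  rw [hsum] at hpost hLpos
  have hmeas : Measurable pstar := by
    rw [funext hpstar]
    exact Measurable.ite hA (hLmeas.div_const c) (hLmeas.const_mul c)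
  have hle : ∀ x, L x / c ≤ c * L x := fun x =>
    (div_le_self (hLnonneg x) hc).trans (le_mul_of_one_le_left (hLnonneg x) hc)
  have hbounds : ∀ x, L x / c ≤ pstar x ∧ pstar x ≤ c * L x := by
    intro x
    rw [hpstar]
    split_ifs
    · exact ⟨le_rfl, hle x⟩
    · exact ⟨hle x, le_rfl⟩
  have hA_int : ∫ x in A, pstar x ∂π = a / c := by
    rw [ha_def, ← integral_div]
    exact setIntegral_congr_fun hA fun x hx => by simp only [hpstar, if_pos hx]
  have hAc_int : ∫ x in Aᶜ, pstar x ∂π = c * b := by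
    rw [hb_def, ← integral_const_mul]
    exact setIntegral_congr_fun hA.compl fun x hx => by simp only [hpstar, if_neg hx]
  have hsplit : ∫ x, pstar x ∂π = a / c + c * b := by
    rw [← integral_add_compl hA
      (integrable_of_densityRatio hc0.le hLnonneg hLint hmeas hbounds), hA_int, hAc_int]
  have hvalue : (∫ x in A, pstar x ∂π) / (∫ x, pstar x ∂π) = α / (α + (1 - α) * c ^ 2) := by
    rw [hA_int, hsplit, ← hpost]
    exact div_add_odds_scaling ha hb hLpos hc0
  refine ⟨⟨hmeas, hbounds⟩, hvalue,
    IsLeast.csInf_eq ⟨⟨pstar, hmeas, hbounds, hvalue.symm⟩, ?_⟩⟩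
  rintro _ ⟨p, hp, hpb, rfl⟩
  have hpint := integrable_of_densityRatio hc0.le hLnonneg hLint hp hpb
  have hlower (s : Set X) : (∫ x in s, L x ∂π) / c ≤ ∫ x in s, p x ∂π := by
    rw [← integral_div]
    exact integral_mono (hLint.integrableOn.div_const c) hpint.integrableOn fun x => (hpb x).1
  have hupper : ∫ x in Aᶜ, p x ∂π ≤ c * b := by
    rw [hb_def, ← integral_const_mul]
    exact integral_mono hpint.integrableOn (hLint.integrableOn.const_mul c) fun x => (hpb x).2
  have hQ : b / c ≤ ∫ x in Aᶜ, p x ∂π := hlower Aᶜ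
  have hP : a / c ≤ ∫ x in A, p x ∂π := hlower A
  have hpos : 0 < a / c + b / c := by
    rw [← add_div]
    exact div_pos hLpos hc0
  rw [← hvalue, hA_int, hsplit, ← integral_add_compl hA hpint]
  exact div_add_le_div_add_of_le (div_nonneg ha hc0.le) ((div_nonneg hb hc0.le).trans hQ) hP hupper
    (by linarith) (by linarith)
end

section
/- (Proposition 1, supremum part.) For every α ∈ (0,1), the supremum over p ∈ R_c of the α-th p-posterior quantile of h equals the (α·c² / (1 − α + α·c²))-th L-posterior quantile of h: sup_{p ∈ R_c} Q_p(α) = Q_L( α·c² / (1 − α + α·c²) ). -/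
open MeasureTheory

/-- The `p`-posterior probability of a set `A`. -/
noncomputable def postProb {X : Type*} [MeasurableSpace X] (π : Measure X)
    (p : X → ℝ) (A : Set X) : ℝ :=
  (∫ x in A, p x ∂π) / (∫ x, p x ∂π)

/-- The `α`-th `p`-posterior quantile of `h`. -/
noncomputable def postQuantile {X : Type*} [MeasurableSpace X] (π : Measure X)
    (p : X → ℝ) (h : X → ℝ) (α : ℝ) : ℝ :=
  sInf {q : ℝ | α ≤ postProb π p {x | h x ≤ q}}

/-- A posterior probability is at least `β` iff the odds are at least `β / (1 - β)`. -/
theorem le_postProb_iff {X : Type*} [MeasurableSpace X] {π : Measure X} {p : X → ℝ}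
    (hp : Integrable p π) (hpos : 0 < ∫ x, p x ∂π) {A : Set X} (hA : MeasurableSet A) (β : ℝ) :
    β ≤ postProb π p A ↔ β * ∫ x in Aᶜ, p x ∂π ≤ (1 - β) * ∫ x in A, p x ∂π := by
  rw [postProb, le_div_iff₀ hpos, ← integral_add_compl hA hp]
  constructor <;> intro h <;> linarith

/-- A posterior probability under `L` is at least `α c² / (1 - α + α c²)` iff the odds, scaled
down by `c²`, are at least `α / (1 - α)`. -/
theorem tilted_le_postProb_iff {X : Type*} [MeasurableSpace X] {π : Measure X} {L : X → ℝ}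
    (hL : Integrable L π) (hpos : 0 < ∫ x, L x ∂π) {A : Set X} (hA : MeasurableSet A)
    {α c : ℝ} (hD : 0 < 1 - α + α * c ^ 2) :
    α * c ^ 2 / (1 - α + α * c ^ 2) ≤ postProb π L A ↔
      α * c ^ 2 * ∫ x in Aᶜ, L x ∂π ≤ (1 - α) * ∫ x in A, L x ∂π := by
  have h1 : 1 - α * c ^ 2 / (1 - α + α * c ^ 2) = (1 - α) / (1 - α + α * c ^ 2) := by
    field_simp
    ring
  rw [le_postProb_iff hL hpos hA, h1, div_mul_eq_mul_div, div_mul_eq_mul_div,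
    div_le_div_iff_of_pos_right hD]

/-- Proposition 1, supremum part: the supremum over the density-ratio class `R_c`
of `α`-th posterior quantiles of `h` equals the `α c² / (1 - α + α c²)`-th
`L`-posterior quantile of `h`. -/
theorem densityRatio_quantile_sup
    {X : Type*} [MeasurableSpace X] (π : Measure X) [SigmaFinite π]
    (L : X → ℝ) (hLmeas : Measurable L) (hLnonneg : ∀ x, 0 ≤ L x)
    (hLint : Integrable L π) (hLpos : 0 < ∫ x, L x ∂π)
    (c : ℝ) (hc : 1 ≤ c)
    (h : X → ℝ) (hmeas : Measurable h)
    (hne : ∀ β ∈ Set.Ioo (0:ℝ) 1, ∀ p : X → ℝ, Measurable p →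
      (∀ x, L x / c ≤ p x ∧ p x ≤ c * L x) →
      {q : ℝ | β ≤ postProb π p {x | h x ≤ q}}.Nonempty ∧
        BddBelow {q : ℝ | β ≤ postProb π p {x | h x ≤ q}})
    (α : ℝ) (hα : α ∈ Set.Ioo (0:ℝ) 1) :
    sSup {r : ℝ | ∃ p : X → ℝ, Measurable p ∧ (∀ x, L x / c ≤ p x ∧ p x ≤ c * L x) ∧
        r = postQuantile π p h α} =
      postQuantile π L h (α * c ^ 2 / (1 - α + α * c ^ 2)) := by
  obtain ⟨hα0, hα1⟩ := hα
  have hc0 : 0 < c := by linarith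
  have h1α : 0 < 1 - α := by linarith
  have hαc : 0 < α * c ^ 2 := by positivity
  have hD : 0 < 1 - α + α * c ^ 2 := by linarith
  have hγ : α * c ^ 2 / (1 - α + α * c ^ 2) ∈ Set.Ioo (0:ℝ) 1 :=
    ⟨by positivity, by rw [div_lt_one hD]; linarith⟩
  have hdiv : ∀ x, L x / c ≤ L x := fun x ↦ div_le_self (hLnonneg x) hc
  have hmul : ∀ x, L x ≤ c * L x := fun x ↦ le_mul_of_one_le_left (hLnonneg x) hc
  have hA : ∀ q, MeasurableSet {x | h x ≤ q} := fun q ↦ hmeas measurableSet_Iic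
  have hpint : ∀ p : X → ℝ, Measurable p → (∀ x, L x / c ≤ p x ∧ p x ≤ c * L x) →
      Integrable p π := fun p hpm hp ↦
    (hLint.const_mul c).mono' hpm.aestronglyMeasurable <| .of_forall fun x ↦ by
      rw [Real.norm_of_nonneg ((div_nonneg (hLnonneg x) hc0.le).trans (hp x).1)]
      exact (hp x).2
  have hppos : ∀ p : X → ℝ, Measurable p → (∀ x, L x / c ≤ p x ∧ p x ≤ c * L x) →
      0 < ∫ x, p x ∂π := fun p hpm hp ↦ by
    have := integral_mono (hLint.div_const c) (hpint p hpm hp) fun x ↦ (hp x).1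
    rw [integral_div] at this
    exact (div_pos hLpos hc0).trans_le this
  obtain ⟨hLne, hLbdd⟩ := hne _ hγ L hLmeas fun x ↦ ⟨hdiv x, hmul x⟩
  refine csSup_eq_of_forall_le_of_forall_lt_exists_gt
    ⟨_, L, hLmeas, fun x ↦ ⟨hdiv x, hmul x⟩, rfl⟩ ?_ ?_
  · rintro _ ⟨p, hpm, hp, rfl⟩
    have hpi := hpint p hpm hp
    refine csInf_le_csInf (hne α ⟨hα0, hα1⟩ p hpm hp).2 hLne fun q hq ↦ ?_
    rw [Set.mem_ofPred_eq, tilted_le_postProb_iff hLint hLpos (hA q) hD] at hq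
    rw [Set.mem_ofPred_eq, le_postProb_iff hpi (hppos p hpm hp) (hA q)]
    have hlow : (∫ x in {x | h x ≤ q}, L x ∂π) / c ≤ ∫ x in {x | h x ≤ q}, p x ∂π := by
      rw [← integral_div]
      exact integral_mono (hLint.div_const c).integrableOn hpi.integrableOn fun x ↦ (hp x).1
    have hupp : ∫ x in {x | h x ≤ q}ᶜ, p x ∂π ≤ c * ∫ x in {x | h x ≤ q}ᶜ, L x ∂π := by
      rw [← integral_const_mul]
      exact integral_mono hpi.integrableOn (hLint.const_mul c).integrableOn fun x ↦ (hp x).2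
    calc α * ∫ x in {x | h x ≤ q}ᶜ, p x ∂π
        ≤ α * (c * ∫ x in {x | h x ≤ q}ᶜ, L x ∂π) := by gcongr
      _ = (α * c ^ 2 * ∫ x in {x | h x ≤ q}ᶜ, L x ∂π) / c := by field_simp
      _ ≤ ((1 - α) * ∫ x in {x | h x ≤ q}, L x ∂π) / c := by gcongr
      _ = (1 - α) * ((∫ x in {x | h x ≤ q}, L x ∂π) / c) := by ring
      _ ≤ (1 - α) * ∫ x in {x | h x ≤ q}, p x ∂π := by gcongr
  · intro w hw
    obtain ⟨q₀, hwq, hq₀⟩ := exists_between hw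
    classical
    let p : X → ℝ := {x | h x ≤ q₀}.piecewise (fun x ↦ L x / c) (fun x ↦ c * L x)
    have hpm : Measurable p :=
      (hLmeas.div_const c).piecewise (hA q₀) (hLmeas.const_mul c)
    have hp : ∀ x, L x / c ≤ p x ∧ p x ≤ c * L x := fun x ↦ by
      have := (hdiv x).trans (hmul x)
      by_cases hx : x ∈ {x | h x ≤ q₀}
      · simpa only [p, Set.piecewise_eq_of_mem _ _ _ hx, le_refl, true_and]
      · simpa only [p, Set.piecewise_eq_of_notMem _ _ _ hx, le_refl, and_true]
    have hpi := hpint p hpm hp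
    have hp0 : ∀ x, 0 ≤ p x := fun x ↦ (div_nonneg (hLnonneg x) hc0.le).trans (hp x).1
    refine ⟨_, ⟨p, hpm, hp, rfl⟩,
      hwq.trans_le (le_csInf (hne α ⟨hα0, hα1⟩ p hpm hp).1 fun q hq ↦ ?_)⟩
    by_contra! hqq
    have hq' : α ≤ postProb π p {x | h x ≤ q₀} := by
      refine le_trans (Set.mem_ofPred_eq ▸ hq) ?_
      unfold postProb
      refine div_le_div_of_nonneg_right ?_ (hppos p hpm hp).le
      exact setIntegral_mono_set hpi.integrableOn (.of_forall hp0)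
        (Filter.Eventually.of_forall fun x (hx : h x ≤ q) ↦ hx.trans hqq.le)
    rw [le_postProb_iff hpi (hppos p hpm hp) (hA q₀),
      setIntegral_congr_fun (hA q₀) (Set.piecewise_eqOn _ _ _),
      setIntegral_congr_fun (hA q₀).compl (Set.piecewise_eqOn_compl _ _ _),
      integral_div, integral_const_mul] at hq'
    refine hq₀.not_ge (csInf_le hLbdd ?_)
    rw [Set.mem_ofPred_eq, tilted_le_postProb_iff hLint hLpos (hA q₀) hD]
    calc α * c ^ 2 * ∫ x in {x | h x ≤ q₀}ᶜ, L x ∂π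
        = c * (α * (c * ∫ x in {x | h x ≤ q₀}ᶜ, L x ∂π)) := by ring
      _ ≤ c * ((1 - α) * ((∫ x in {x | h x ≤ q₀}, L x ∂π) / c)) := by gcongr
      _ = (1 - α) * ∫ x in {x | h x ≤ q₀}, L x ∂π := by field_simp
end

section
/- (Counterfactual income system in the Armington model.) Fix n ≥ 1 and ε ∈ ℝ. Let τ, τ̂, χ : {1,…,n}×{1,…,n} → (0,∞), let κ : {1,…,n} → ℝ, and let F, F' : {1,…,n}×{1,…,n} → ℝ be baseline and counterfactual flows with induced incomes Y_i = Σ_ℓ F_{iℓ} > 0, Y'_i = Σ_ℓ F'_{iℓ} > 0 and expenditures E_j = Σ_k F_{kj}, E'_j = Σ_k F'_{kj}. Assume both equilibria satisfy the gravity equation and budget constraint with the same χ and κ: F_{ij} = [(τ_{ij} Y_i)^{−ε} χ_{ij} / Σ_k (τ_{kj} Y_k)^{−ε} χ_{kj}]·E_j and E_j = (1 + κ_j)·Y_j for all i, j, and likewise F'_{ij} = [((τ̂_{ij} τ_{ij}) Y'_i)^{−ε} χ_{ij} / Σ_k ((τ̂_{kj} τ_{kj}) Y'_k)^{−ε} χ_{kj}]·E'_j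 and E'_j = (1 + κ_j)·Y'_j, with E_j ≠ 0 for all j. Define Ŷ_i = Y'_i / Y_i and λ_{ij} = F_{ij}/E_j. Then for every i: Ŷ_i·Y_i = Σ_{j=1}^n [ (τ̂_{ij}·Ŷ_i)^{−ε} / Σ_{k=1}^n λ_{kj}·(τ̂_{kj}·Ŷ_k)^{−ε} ] · λ_{ij}·(1 + κ_j)·Ŷ_j·Y_j. -/
/-- Counterfactual income system in the Armington model: if both the baseline and the
counterfactual equilibria satisfy the gravity equation and budget constraint with the
same preference terms `χ` and deficit ratios `κ`, then the proportional income changes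
`Ŷ_i = Y'_i / Y_i` solve
`Ŷ_i Y_i = Σ_j [(τ̂_{ij} Ŷ_i)^{-ε} / Σ_k λ_{kj} (τ̂_{kj} Ŷ_k)^{-ε}] λ_{ij} (1+κ_j) Ŷ_j Y_j`. -/
theorem armington_counterfactual_income_system
    (n : ℕ) (hn : 1 ≤ n) (ε : ℝ)
    (τ τhat χ : Fin n → Fin n → ℝ) (κ : Fin n → ℝ)
    (F F' : Fin n → Fin n → ℝ)
    (Y Y' E E' : Fin n → ℝ)
    (hτ : ∀ i j, 0 < τ i j) (hτhat : ∀ i j, 0 < τhat i j) (hχ : ∀ i j, 0 < χ i j)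
    (hYdef : ∀ i, Y i = ∑ ℓ, F i ℓ) (hY'def : ∀ i, Y' i = ∑ ℓ, F' i ℓ)
    (hEdef : ∀ j, E j = ∑ k, F k j) (hE'def : ∀ j, E' j = ∑ k, F' k j)
    (hYpos : ∀ i, 0 < Y i) (hY'pos : ∀ i, 0 < Y' i)
    (hgrav : ∀ i j, F i j =
      (τ i j * Y i) ^ (-ε) * χ i j / (∑ k, (τ k j * Y k) ^ (-ε) * χ k j) * E j)
    (hbal : ∀ j, E j = (1 + κ j) * Y j)
    (hgrav' : ∀ i j, F' i j =
      (τhat i j * τ i j * Y' i) ^ (-ε) * χ i j /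
        (∑ k, (τhat k j * τ k j * Y' k) ^ (-ε) * χ k j) * E' j)
    (hbal' : ∀ j, E' j = (1 + κ j) * Y' j)
    (hEne : ∀ j, E j ≠ 0)
    (Yhat : Fin n → ℝ) (hYhat : ∀ i, Yhat i = Y' i / Y i)
    (lam : Fin n → Fin n → ℝ) (hlam : ∀ i j, lam i j = F i j / E j) :
    ∀ i, Yhat i * Y i =
      ∑ j, (τhat i j * Yhat i) ^ (-ε) /
          (∑ k, lam k j * (τhat k j * Yhat k) ^ (-ε)) *
        (lam i j * ((1 + κ j) * (Yhat j * Y j))) := by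
  intro i
  have hYY : ∀ j, Yhat j * Y j = Y' j := fun j => by
    rw [hYhat, div_mul_cancel₀ _ (hYpos j).ne']
  have hYhat_pos : ∀ j, 0 < Yhat j := fun j => by
    rw [hYhat]; exact div_pos (hY'pos j) (hYpos j)
  have hweight : ∀ k j, (τhat k j * τ k j * Y' k) ^ (-ε) =
      (τhat k j * Yhat k) ^ (-ε) * (τ k j * Y k) ^ (-ε) := fun k j => by
    rw [← Real.mul_rpow (mul_pos (hτhat k j) (hYhat_pos k)).le (mul_pos (hτ k j) (hYpos k)).le,
      ← hYY k]
    congr 1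
    ring
  have hshare : ∀ k j, lam k j =
      (τ k j * Y k) ^ (-ε) * χ k j / ∑ l, (τ l j * Y l) ^ (-ε) * χ l j := fun k j => by
    rw [hlam, hgrav, mul_div_cancel_right₀ _ (hEne j)]
  rw [hYY, hY'def]
  refine Finset.sum_congr rfl fun j _ => ?_
  have hD : 0 < ∑ l, (τ l j * Y l) ^ (-ε) * χ l j :=
    Finset.sum_pos
      (fun l _ => mul_pos (Real.rpow_pos_of_pos (mul_pos (hτ l j) (hYpos l)) _) (hχ l j))
      ⟨i, Finset.mem_univ i⟩
  have hsum : ∑ k, lam k j * (τhat k j * Yhat k) ^ (-ε) =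
      (∑ k, (τhat k j * τ k j * Y' k) ^ (-ε) * χ k j) /
        ∑ l, (τ l j * Y l) ^ (-ε) * χ l j := by
    rw [Finset.sum_div]
    refine Finset.sum_congr rfl fun k _ => ?_
    rw [hshare, hweight]
    ring
  rw [hgrav', hbal', hsum, hshare, hYY, hweight i j]
  field_simp
end
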